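/- arXiv:1709.01633 — 3 statements merged into one kernel-verified Lean document; each statement's English description precedes it below -/
import Mathlib

section
/- For s ∈ V, define the commute time through s as κ_s(ω) = inf{k ∈ ℕ : X_k(ω) = X_0(ω) and there exists j with 0 < j < k and X_j(ω) = s} (equal to ∞ if no such k exists), taking values in [0,∞]. For a nonempty finite set S ⊆ V, define K(S) = ∫⁻ (min_{s ∈ S} κ_s(ω)) dμ(ω) ∈ [0,∞], the expected time to reach some node of S and return to the starting state. Then K is supermodular: for all nonempty finite S ⊆ T ⊆ V and all v ∈ V with v ∉ T, K(S ∪ {v}) + K(T) ≤ K(S) + K(T ∪ {v}). -/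
open MeasureTheory

/-- The commute time through the state `s`: the first time `k` at which the
process has returned to its starting state `X 0 ω` after having visited `s`
at some intermediate time `0 < j < k`; equal to `∞` if no such `k` exists. -/
noncomputable def commuteTime {Ω V : Type*} (X : ℕ → Ω → V) (s : V) (ω : Ω) : ENNReal :=
  ⨅ (k : ℕ) (_ : X k ω = X 0 ω ∧ ∃ j : ℕ, 0 < j ∧ j < k ∧ X j ω = s), (k : ENNReal)

/-- The expected commute time
`K S = ∫⁻ ω, min_{s ∈ S} κ_s ω ∂μ` of a nonempty finite target set `S`
(the expected time to reach some node of `S` and return to the start) is a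
supermodular function of `S`. -/
theorem expected_commute_time_supermodular
    {Ω : Type*} [MeasurableSpace Ω] (μ : Measure Ω) [IsProbabilityMeasure μ]
    {V : Type*} [Fintype V] [Nonempty V] [DecidableEq V] [MeasurableSpace V]
    (X : ℕ → Ω → V) (hX : ∀ k, Measurable (X k))
    (K : Finset V → ENNReal)
    (hK : ∀ S : Finset V, K S = ∫⁻ ω, S.inf (fun s => commuteTime X s ω) ∂μ)
    (S T : Finset V) (hS : S.Nonempty) (hST : S ⊆ T) (v : V) (hv : v ∉ T) :
    K (insert v S) + K T ≤ K S + K (insert v T) := by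
  simp only [hK]
  obtain ⟨P, hPm, hP, hPe⟩ := exists_measurable_le_lintegral_eq μ
    (fun ω => (insert v S).inf (fun s => commuteTime X s ω))
  obtain ⟨Q, hQm, hQ, hQe⟩ := exists_measurable_le_lintegral_eq μ
    (fun ω => T.inf (fun s => commuteTime X s ω))
  rw [hPe, hQe, ← lintegral_add_left hPm]
  have e : ∀ ω, P ω + Q ω = max (P ω) (Q ω) + min (P ω) (Q ω) :=
    fun ω => (max_add_min (P ω) (Q ω)).symm
  simp only [e]
  rw [lintegral_add_left (hPm.max hQm)]
  refine add_le_add (lintegral_mono fun ω => ?_) (lintegral_mono fun ω => ?_)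
  · exact max_le ((hP ω).trans (Finset.inf_mono (Finset.subset_insert v S)))
      ((hQ ω).trans (Finset.inf_mono hST))
  · have h1 := hP ω
    have h2 := hQ ω
    simp only [Finset.inf_insert] at h1 ⊢
    exact le_inf ((min_le_left _ _).trans (h1.trans inf_le_left)) ((min_le_right _ _).trans h2)
end

section
/- Let λ ≥ 0 and ζ > 0. For each finite set S ⊆ V, let 𝒫(λ,S) = {h : V → ℝ : |h(i)| ≤ ζ for all i ∈ V, and h(i) − ∑_{j ∈ V} P(i,a,j)·h(j) ≤ 1 − λ·𝟙[i ∈ S] for all i ∈ V and all a ∈ Act(i)}, and let r_λ(S) be the Lebesgue volume of 𝒫(λ,S) in the n-dimensional space of functions V → ℝ. Then r_λ is nonincreasing and supermodular as a function of S: for all finite S ⊆ T ⊆ V and all v ∈ V with v ∉ T, r_λ(T) ≤ r_λ(S) and r_λ(S ∪ {v}) + r_λ(T) ≤ r_λ(S) + r_λ(T ∪ {v}). -/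
open MeasureTheory

/-- For an MDP with finite state space `V`, finite action
space `A`, admissible actions `Act` and transition probabilities `P`, and for
`λ ≥ 0`, `ζ > 0`, the Lebesgue volume `r_λ(S)` of the polytope
`𝒫(λ,S) = {h : V → ℝ | ‖h‖_∞ ≤ ζ, h i − ∑ j P(i,a,j) h j ≤ 1 − λ·𝟙[i ∈ S]}`
is nonincreasing and supermodular as a function of the finite set `S`. -/
theorem acpc_polytope_volume_antitone_and_supermodular
    {V A : Type*} [Fintype V] [Nonempty V] [DecidableEq V] [Fintype A]
    (Act : V → Finset A) (P : V → A → V → ℝ)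
    (hP : ∀ i, ∀ a ∈ Act i, (∀ j, 0 ≤ P i a j) ∧ (∑ j, P i a j) = 1)
    (lam : ℝ) (hlam : 0 ≤ lam) (ζ : ℝ) (hζ : 0 < ζ)
    (r : Finset V → ENNReal)
    (hr : ∀ S : Finset V, r S =
      volume {h : V → ℝ | (∀ i, |h i| ≤ ζ) ∧
        ∀ i, ∀ a ∈ Act i,
          h i - ∑ j, P i a j * h j ≤ 1 - lam * (if i ∈ S then 1 else 0)})
    (S T : Finset V) (hST : S ⊆ T) (v : V) (hv : v ∉ T) :
    r T ≤ r S ∧ r (insert v S) + r T ≤ r S + r (insert v T) := by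
  have hmono : ∀ S T : Finset V, S ⊆ T → ∀ i,
      1 - lam * (if i ∈ T then (1 : ℝ) else 0) ≤ 1 - lam * (if i ∈ S then 1 else 0) := by
    intro S T h i
    by_cases h1 : i ∈ S
    · simp [h1, h h1]
    · by_cases h2 : i ∈ T <;> simp [h1, h2, hlam]
  have hsub : ∀ S T : Finset V, S ⊆ T →
      {h : V → ℝ | (∀ i, |h i| ≤ ζ) ∧ ∀ i, ∀ a ∈ Act i,
          h i - ∑ j, P i a j * h j ≤ 1 - lam * (if i ∈ T then 1 else 0)} ⊆
      {h : V → ℝ | (∀ i, |h i| ≤ ζ) ∧ ∀ i, ∀ a ∈ Act i,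
          h i - ∑ j, P i a j * h j ≤ 1 - lam * (if i ∈ S then 1 else 0)} := by
    intro S T h x hx
    exact ⟨hx.1, fun i a ha => (hx.2 i a ha).trans (hmono S T h i)⟩
  have hmeas : MeasurableSet {h : V → ℝ | (∀ i, |h i| ≤ ζ) ∧ ∀ i, ∀ a ∈ Act i,
          h i - ∑ j, P i a j * h j ≤ 1 - lam * (if i ∈ T then 1 else 0)} := by
    apply IsClosed.measurableSet
    simp only [Set.setOf_and, Set.setOf_forall]
    refine IsClosed.inter (isClosed_iInter fun i => ?_)
      (isClosed_iInter fun i => isClosed_iInter fun a => isClosed_iInter fun _ => ?_)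
    · exact isClosed_le (by fun_prop) continuous_const
    · exact isClosed_le (by fun_prop) continuous_const
  refine ⟨?_, ?_⟩
  · rw [hr, hr]
    exact measure_mono (hsub S T hST)
  · rw [hr (insert v S), hr T, hr S, hr (insert v T), ← measure_union_add_inter _ hmeas]
    refine add_le_add (measure_mono (Set.union_subset
      (hsub _ _ (Finset.subset_insert v S)) (hsub _ _ hST))) (measure_mono ?_)
    rintro x ⟨h1, h2⟩
    refine ⟨h1.1, fun i a ha => ?_⟩
    by_cases hi : i = v
    · have := h1.2 i a ha
      simpa [hi] using this
    · have := h2.2 i a ha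
      simpa [hi] using this
end

section
/- Let R, S ⊆ V with S ∩ R = ∅, and let F = {x : V → ℝ : 0 ≤ x(i) ≤ 1 for all i; x(i) = 0 for all i ∈ R; and x(i) ≥ ∑_{j ∈ V} P(i,a,j)·x(j) for all i ∉ R and all a ∈ Act(i)}. For ρ ∈ ℝ with ρ > n, define J(x) = ∑_{i ∈ V} x(i) + ρ·∑_{i ∈ S} (1 − x(i)). Then: (a) every x* ∈ F that minimizes J over F satisfies x*(i) = 1 for all i ∈ S; and (b) the infimum of J over F equals the infimum of ∑_{i ∈ V} x(i) over {x ∈ F : x(i) = 1 for all i ∈ S}. -/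
/-- Consider the feasible polytope `F` of the maximal
reachability linear program for an MDP (with unsafe set `R` and target set
`S`, `S ∩ R = ∅`) and the penalized objective
`J x = ∑ i x i + ρ ∑_{i ∈ S} (1 − x i)` with penalty `ρ > n`. Then
(a) every minimizer `x*` of `J` over `F` satisfies `x* i = 1` for all `i ∈ S`,
and (b) the infimum of `J` over `F` equals the infimum of `∑ i x i` over the
points of `F` satisfying `x i = 1` for all `i ∈ S`. -/
theorem relaxed_reachability_equivalent
    {V A : Type*} [Fintype V] [Fintype A]
    (Act : V → Finset A) (P : V → A → V → ℝ)
    (hP : ∀ i, ∀ a ∈ Act i, (∀ j, 0 ≤ P i a j) ∧ (∑ j, P i a j) = 1)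
    (R S : Finset V) (hRS : Disjoint S R)
    (ρ : ℝ) (hρ : (Fintype.card V : ℝ) < ρ)
    (F : Set (V → ℝ))
    (hF : F = {x : V → ℝ | (∀ i, 0 ≤ x i ∧ x i ≤ 1) ∧ (∀ i ∈ R, x i = 0) ∧
      ∀ i ∉ R, ∀ a ∈ Act i, (∑ j, P i a j * x j) ≤ x i})
    (J : (V → ℝ) → ℝ)
    (hJ : J = fun x => (∑ i, x i) + ρ * ∑ i ∈ S, (1 - x i)) :
    (∀ x ∈ F, (∀ y ∈ F, J x ≤ J y) → ∀ i ∈ S, x i = 1) ∧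
    sInf (J '' F) = sInf ((fun x => ∑ i, x i) '' {x ∈ F | ∀ i ∈ S, x i = 1}) := by
  classical
  have key : ∀ x ∈ F, ∃ y ∈ F, (∀ i ∈ S, y i = 1) ∧
      J y + (ρ - Fintype.card V) * ∑ i ∈ S, (1 - x i) ≤ J x := by
    intro x hx
    rw [hF] at hx
    obtain ⟨hb, hR, hc⟩ := hx
    set d := ∑ i ∈ S, (1 - x i) with hd
    have hd0 : 0 ≤ d := Finset.sum_nonneg fun i _ => by linarith [(hb i).2]
    have hdi : ∀ i ∈ S, 1 - x i ≤ d := fun i hi =>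
      Finset.single_le_sum (f := fun i => 1 - x i)
        (fun j _ => by linarith [(hb j).2]) hi
    let y : V → ℝ := fun i => if i ∈ R then 0 else min 1 (x i + d)
    have hy0 : ∀ i, 0 ≤ y i := by
      intro i
      simp only [y]
      split_ifs
      · exact le_rfl
      · exact le_min zero_le_one (add_nonneg (hb i).1 hd0)
    have hy1 : ∀ i, y i ≤ 1 := by
      intro i
      simp only [y]
      split_ifs
      · exact zero_le_one
      · exact min_le_left _ _
    have hyx : ∀ i, y i ≤ x i + d := by
      intro i
      simp only [y]
      split_ifs
      · exact add_nonneg (hb i).1 hd0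
      · exact min_le_right _ _
    have hyS : ∀ i ∈ S, y i = 1 := by
      intro i hi
      have hiR : i ∉ R := Finset.disjoint_left.mp hRS hi
      simp only [y, if_neg hiR]
      exact min_eq_left (by linarith [hdi i hi])
    refine ⟨y, ?_, hyS, ?_⟩
    · rw [hF]
      refine ⟨fun i => ⟨hy0 i, hy1 i⟩, fun i hi => by simp [y, hi], ?_⟩
      intro i hi a ha
      obtain ⟨hp, hs⟩ := hP i a ha
      have e1 : ∑ j, P i a j * y j ≤ 1 := by
        rw [← hs]
        exact Finset.sum_le_sum fun j _ => mul_le_of_le_one_right (hp j) (hy1 j)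
      have e2 : ∑ j, P i a j * y j ≤ x i + d := by
        calc ∑ j, P i a j * y j ≤ ∑ j, P i a j * (x j + d) :=
              Finset.sum_le_sum fun j _ => mul_le_mul_of_nonneg_left (hyx j) (hp j)
          _ = ∑ j, P i a j * x j + d := by
              simp only [mul_add, Finset.sum_add_distrib, ← Finset.sum_mul, hs, one_mul]
          _ ≤ x i + d := by linarith [hc i hi a ha]
      have e3 : y i = min 1 (x i + d) := by simp only [y, if_neg hi]
      rw [e3]
      exact le_min e1 e2
    · have e1 : ∑ i ∈ S, (1 - y i) = 0 :=
        Finset.sum_eq_zero fun i hi => by rw [hyS i hi, sub_self]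
      have e2 : ∑ i, y i ≤ ∑ i, x i + Fintype.card V * d := by
        calc ∑ i, y i ≤ ∑ i, (x i + d) := Finset.sum_le_sum fun i _ => hyx i
          _ = _ := by simp [Finset.sum_add_distrib]
      simp only [hJ, e1, ← hd]
      linarith
  have hdn : ∀ x ∈ F, 0 ≤ ∑ i ∈ S, (1 - x i) := by
    intro x hx
    rw [hF] at hx
    exact Finset.sum_nonneg fun i _ => by linarith [(hx.1 i).2]
  have hsn : ∀ x ∈ F, 0 ≤ ∑ i, x i := by
    intro x hx
    rw [hF] at hx
    exact Finset.sum_nonneg fun i _ => (hx.1 i).1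
  have hρ0 : 0 ≤ ρ := (Nat.cast_nonneg _).trans hρ.le
  have hJS : ∀ x : V → ℝ, (∀ i ∈ S, x i = 1) → J x = ∑ i, x i := by
    intro x hx
    have e1 : ∑ i ∈ S, (1 - x i) = 0 :=
      Finset.sum_eq_zero fun i hi => by rw [hx i hi, sub_self]
    simp only [hJ, e1, mul_zero, add_zero]
  constructor
  · intro x hx hmin i hi
    obtain ⟨y, hy, -, hle⟩ := key x hx
    have h1 := hmin y hy
    have h2 := hdn x hx
    have h3 : ∑ i ∈ S, (1 - x i) = 0 := by
      by_contra hne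
      have := mul_pos (sub_pos.mpr hρ) (lt_of_le_of_ne h2 (Ne.symm hne))
      linarith
    have hx' := hx
    rw [hF] at hx'
    have := (Finset.sum_eq_zero_iff_of_nonneg
      (fun j _ => by linarith [(hx'.1 j).2])).mp h3 i hi
    linarith
  · have h0 : (0 : V → ℝ) ∈ F := by
      rw [hF]
      refine ⟨fun i => ⟨le_rfl, zero_le_one⟩, fun i _ => rfl, ?_⟩
      intro i _ a _
      simp
    obtain ⟨y0, hy0, hy0S, -⟩ := key 0 h0
    apply le_antisymm
    · apply le_csInf
      · exact ⟨_, y0, ⟨hy0, hy0S⟩, rfl⟩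
      · rintro _ ⟨x, ⟨hx, hxS⟩, rfl⟩
        refine csInf_le ⟨0, ?_⟩ ⟨x, hx, hJS x hxS⟩
        rintro _ ⟨z, hz, rfl⟩
        simp only [hJ]
        exact add_nonneg (hsn z hz) (mul_nonneg hρ0 (hdn z hz))
    · apply le_csInf
      · exact ⟨_, 0, h0, rfl⟩
      · rintro _ ⟨x, hx, rfl⟩
        obtain ⟨y, hy, hyS, hle⟩ := key x hx
        have h1 := mul_nonneg (sub_pos.mpr hρ).le (hdn x hx)
        have h2 : sInf ((fun x => ∑ i, x i) '' {x ∈ F | ∀ i ∈ S, x i = 1}) ≤ ∑ i, y i := by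
          refine csInf_le ⟨0, ?_⟩ ⟨y, ⟨hy, hyS⟩, rfl⟩
          rintro _ ⟨z, ⟨hz, -⟩, rfl⟩
          exact hsn z hz
        rw [← hJS y hyS] at h2
        linarith
end
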